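/- Let BH^{=d}_{[-1,1]} denote the smallest constant C ≥ 1 such that for every n ∈ ℕ and every d-homogeneous real polynomial P(x) = ∑_{α ∈ ℕ₀^n, |α| = d} a_α x^α one has (∑_{|α| = d} |a_α|^{2d/(d+1)})^{(d+1)/(2d)} ≤ C · sup_{x ∈ [-1,1]^n} |P(x)|. Then limsup_{d → ∞} (BH^{=d}_{[-1,1]})^{1/d} = 2. -/

import Mathlib

open Finset

/-- The sup norm of a real polynomial in `n` variables over the cube `[-1,1]^n`. -/
noncomputable def supOnBox {n : ℕ} (P : MvPolynomial (Fin n) ℝ) : ℝ :=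
  sSup {y : ℝ | ∃ x : Fin n → ℝ, (∀ i, x i ∈ Set.Icc (-1 : ℝ) 1) ∧
    y = |MvPolynomial.eval x P|}

/-- `C` is an admissible Bohnenblust–Hille constant for `d`-homogeneous real polynomials
on `[-1,1]^n` (for all `n`). -/
def IsHomBHConst (d : ℕ) (C : ℝ) : Prop :=
  1 ≤ C ∧ ∀ (n : ℕ) (P : MvPolynomial (Fin n) ℝ), P.IsHomogeneous d →
    (∑ α ∈ P.support, |P.coeff α| ^ ((2 * d : ℝ) / (d + 1))) ^ ((d + 1 : ℝ) / (2 * d))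
      ≤ C * supOnBox P

/-- The exponent vectors of the monomials of degree `m` in `n` variables. -/
abbrev multiIdx (n m : ℕ) : Finset (Fin n → ℕ) := (univ : Finset (Fin n)).piAntidiag m

lemma mem_multiIdx {n m : ℕ} {α : Fin n → ℕ} : α ∈ multiIdx n m ↔ ∑ i, α i = m := by
  simp [multiIdx]

/-- Value at `z` of the `m`-homogeneous polynomial with coefficients `a`. -/
noncomputable def homEval {n : ℕ} (m : ℕ) (a : (Fin n → ℕ) → ℂ) (z : Fin n → ℂ) : ℂ :=
  ∑ α ∈ multiIdx n m, a α * ∏ i, z i ^ α i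

lemma le_of_mem_multiIdx {n m : ℕ} {α : Fin n → ℕ} (h : α ∈ multiIdx n m) (i : Fin n) :
    α i ≤ m := by
  rw [← mem_multiIdx.1 h]
  exact Finset.single_le_sum (f := α) (fun _ _ => Nat.zero_le _) (Finset.mem_univ i)

section RootsOfUnity

variable {ζ : ℂ} {M : ℕ}

lemma sum_pow_mul_conj (hζ : IsPrimitiveRoot ζ M) {j k : ℕ} (hj : j < M) (hk : k < M) :
    ∑ x ∈ range M, (ζ ^ x) ^ j * (starRingEnd ℂ) ((ζ ^ x) ^ k) = if j = k then (M : ℂ) else 0 := by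
  have hM : M ≠ 0 := by omega
  have hn : ‖ζ‖ = 1 := hζ.norm'_eq_one hM
  have hc : ζ * (starRingEnd ℂ) ζ = 1 := by
    rw [Complex.mul_conj, Complex.normSq_eq_norm_sq, hn]; simp
  have hterm : ∀ x ∈ range M, (ζ ^ x) ^ j * (starRingEnd ℂ) ((ζ ^ x) ^ k)
      = (ζ ^ j * (starRingEnd ℂ) ζ ^ k) ^ x := by
    intro x _
    simp only [map_pow]
    ring
  rw [Finset.sum_congr rfl hterm]
  split_ifs with h
  · subst h
    rw [← mul_pow, hc]
    simp
  · set η := ζ ^ j * (starRingEnd ℂ) ζ ^ k with hη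
    have h1 : η ≠ 1 := by
      intro h1
      apply h
      apply hζ.pow_inj hj hk
      calc ζ ^ j = η * ζ ^ k := by
            rw [hη, mul_assoc, ← mul_pow, mul_comm _ ζ, hc]; simp
        _ = ζ ^ k := by rw [h1, one_mul]
    have h2 : η ^ M = 1 := by
      rw [hη, mul_pow, ← pow_mul, ← pow_mul, mul_comm j, mul_comm k, pow_mul, pow_mul, ← map_pow,
        hζ.pow_eq_one]
      simp
    have h3 := mul_geom_sum η M
    rw [h2, sub_self] at h3
    exact (mul_eq_zero.1 h3).resolve_left (sub_ne_zero.2 h1)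

/-- The grid on which multi-index exponents of powers of a root of unity range. -/
abbrev rootGrid (n M : ℕ) : Finset (Fin n → ℕ) := Fintype.piFinset fun _ => range M

/-- Parseval's identity on the group of roots of unity. -/
lemma sum_norm_sq_eq {n : ℕ} (hζ : IsPrimitiveRoot ζ M) (S : Finset (Fin n → ℕ))
    (hS : ∀ α ∈ S, ∀ i, α i < M) (q : (Fin n → ℕ) → ℂ) :
    ∑ x ∈ rootGrid n M, ‖∑ α ∈ S, q α * ∏ i, (ζ ^ x i) ^ α i‖ ^ 2
      = (M : ℝ) ^ n * ∑ α ∈ S, ‖q α‖ ^ 2 := by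
  have hsq : ∀ w : ℂ, ((‖w‖ ^ 2 : ℝ) : ℂ) = w * (starRingEnd ℂ) w := fun w => by
    rw [Complex.mul_conj, Complex.normSq_eq_norm_sq]
  apply Complex.ofReal_injective
  rw [Complex.ofReal_sum, Complex.ofReal_mul, Complex.ofReal_sum]
  simp only [hsq, map_sum, Finset.sum_mul_sum, map_mul, map_prod]
  rw [Finset.sum_comm, Finset.mul_sum]
  refine Finset.sum_congr rfl fun α hα => ?_
  rw [Finset.sum_comm]
  have key : ∀ β ∈ S, ∑ x ∈ rootGrid n M, (q α * ∏ i, (ζ ^ x i) ^ α i) *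
      ((starRingEnd ℂ) (q β) * ∏ i, (starRingEnd ℂ) ((ζ ^ x i) ^ β i))
      = if α = β then (M : ℂ) ^ n * (q α * (starRingEnd ℂ) (q α)) else 0 := by
    intro β hβ
    have : ∑ x ∈ rootGrid n M, ∏ i, ((ζ ^ x i) ^ α i * (starRingEnd ℂ) ((ζ ^ x i) ^ β i))
        = if α = β then (M : ℂ) ^ n else 0 := by
      rw [rootGrid, ← Finset.prod_univ_sum (fun _ : Fin n => range M)
        (fun i y => (ζ ^ y) ^ α i * (starRingEnd ℂ) ((ζ ^ y) ^ β i))]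
      rw [Finset.prod_congr rfl fun i _ => sum_pow_mul_conj hζ (hS α hα i) (hS β hβ i)]
      split_ifs with h
      · subst h; simp
      · obtain ⟨i, hi⟩ := Function.ne_iff.1 h
        exact Finset.prod_eq_zero (Finset.mem_univ i) (by simp [hi])
    calc _ = q α * (starRingEnd ℂ) (q β) *
          ∑ x ∈ rootGrid n M, ∏ i, ((ζ ^ x i) ^ α i * (starRingEnd ℂ) ((ζ ^ x i) ^ β i)) := by
          rw [Finset.mul_sum]
          refine Finset.sum_congr rfl fun x _ => ?_
          rw [Finset.prod_mul_distrib]; ring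
      _ = _ := by
          rw [this]
          split_ifs with h
          · subst h; ring
          · simp
  rw [Finset.sum_congr rfl key, Finset.sum_ite_eq, if_pos hα]
  simp

lemma card_antidiagonal_le {n m : ℕ} (δ : Fin n → ℕ) (hδ : δ ∈ multiIdx n (2 * m)) :
    #{p ∈ multiIdx n m ×ˢ multiIdx n m | p.1 + p.2 = δ} ≤ 4 ^ m := by
  calc #{p ∈ multiIdx n m ×ˢ multiIdx n m | p.1 + p.2 = δ}
      ≤ #(Fintype.piFinset fun i => range (δ i + 1)) := by
        refine Finset.card_le_card_of_injOn Prod.fst ?_ ?_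
        · intro p hp
          simp only [coe_filter, Set.mem_ofPred_eq] at hp
          simp only [Finset.mem_coe, Fintype.mem_piFinset, mem_range]
          intro i
          have := congrFun hp.2 i
          simp only [Pi.add_apply] at this
          omega
        · intro p hp p' hp' h
          simp only [coe_filter, Set.mem_ofPred_eq] at hp hp'
          refine Prod.ext h ?_
          have := hp.2.trans hp'.2.symm
          rw [h] at this
          exact add_left_cancel this
    _ = ∏ i, (δ i + 1) := by simp
    _ ≤ ∏ i, 2 ^ δ i := Finset.prod_le_prod' fun i _ => Nat.lt_two_pow_self
    _ = 4 ^ m := by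
        rw [Finset.prod_pow_eq_pow_sum, mem_multiIdx.1 hδ, pow_mul]; norm_num

lemma homEval_sq {n m : ℕ} (q : (Fin n → ℕ) → ℂ) (z : Fin n → ℂ) :
    homEval m q z ^ 2 = homEval (2 * m) (fun δ =>
      ∑ p ∈ multiIdx n m ×ˢ multiIdx n m with p.1 + p.2 = δ, q p.1 * q p.2) z := by
  simp only [homEval, sq, Finset.sum_mul_sum]
  rw [← Finset.sum_product', ← Finset.sum_fiberwise_of_maps_to (t := multiIdx n (2 * m))
    (g := fun p : (Fin n → ℕ) × (Fin n → ℕ) => p.1 + p.2)]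
  · refine Finset.sum_congr rfl fun δ _ => ?_
    rw [Finset.sum_mul]
    refine Finset.sum_congr rfl fun p hp => ?_
    rw [← (Finset.mem_filter.1 hp).2]
    simp only [Pi.add_apply, pow_add, Finset.prod_mul_distrib]
    ring
  · intro p hp
    rw [Finset.mem_product, mem_multiIdx, mem_multiIdx] at hp
    rw [mem_multiIdx]
    simp only [Pi.add_apply, Finset.sum_add_distrib, hp.1, hp.2]
    ring

/-- The `L⁴` norm of a homogeneous polynomial is controlled by its `L²` norm. -/
lemma sum_norm_pow_four_le {n m : ℕ} (hζ : IsPrimitiveRoot ζ M) (hM : 2 * m < M)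
    (q : (Fin n → ℕ) → ℂ) :
    ∑ x ∈ rootGrid n M, ‖homEval m q fun i => ζ ^ x i‖ ^ 4
      ≤ (M : ℝ) ^ n * (4 ^ m * (∑ α ∈ multiIdx n m, ‖q α‖ ^ 2) ^ 2) := by
  have h1 : ∀ x ∈ rootGrid n M, ‖homEval m q fun i => ζ ^ x i‖ ^ 4
      = ‖homEval (2 * m) (fun δ => ∑ p ∈ multiIdx n m ×ˢ multiIdx n m with p.1 + p.2 = δ,
        q p.1 * q p.2) fun i => ζ ^ x i‖ ^ 2 := by
    intro x _
    rw [← homEval_sq, norm_pow]; ring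
  rw [Finset.sum_congr rfl h1]
  simp only [homEval]
  rw [sum_norm_sq_eq hζ _ (fun α hα i => (le_of_mem_multiIdx hα i).trans_lt hM)]
  gcongr
  calc ∑ δ ∈ multiIdx n (2 * m),
        ‖∑ p ∈ multiIdx n m ×ˢ multiIdx n m with p.1 + p.2 = δ, q p.1 * q p.2‖ ^ 2
      ≤ ∑ δ ∈ multiIdx n (2 * m), 4 ^ m *
        ∑ p ∈ multiIdx n m ×ˢ multiIdx n m with p.1 + p.2 = δ, ‖q p.1‖ ^ 2 * ‖q p.2‖ ^ 2 := by
        refine Finset.sum_le_sum fun δ hδ => ?_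
        calc _ ≤ (∑ p ∈ multiIdx n m ×ˢ multiIdx n m with p.1 + p.2 = δ, ‖q p.1 * q p.2‖) ^ 2 := by
              gcongr; exact norm_sum_le _ _
          _ ≤ _ := sq_sum_le_card_mul_sum_sq
          _ ≤ _ := by
              simp only [norm_mul, mul_pow]
              gcongr
              exact_mod_cast card_antidiagonal_le δ hδ
    _ = 4 ^ m * (∑ α ∈ multiIdx n m, ‖q α‖ ^ 2) ^ 2 := by
        rw [← Finset.mul_sum, Finset.sum_fiberwise_of_maps_to (t := multiIdx n (2 * m))
          (g := fun p : (Fin n → ℕ) × (Fin n → ℕ) => p.1 + p.2), Finset.sum_product, sq,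
          Finset.sum_mul_sum]
        intro p hp
        rw [Finset.mem_product, mem_multiIdx, mem_multiIdx] at hp
        rw [mem_multiIdx]
        simp only [Pi.add_apply, Finset.sum_add_distrib, hp.1, hp.2]
        ring

/-- Comparison of the `L²` norm of a homogeneous polynomial with its `L^{2k/(k+1)}` norm. -/
lemma sum_norm_sq_rpow_le {n m k : ℕ} (hk : 1 ≤ k) (hζ : IsPrimitiveRoot ζ M) (hM : 2 * m < M)
    (q : (Fin n → ℕ) → ℂ) :
    (M : ℝ) ^ n * (∑ α ∈ multiIdx n m, ‖q α‖ ^ 2) ^ ((k : ℝ) / (k + 1))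
      ≤ (4 : ℝ) ^ ((m : ℝ) / (k + 1)) *
        ∑ x ∈ rootGrid n M, ‖homEval m q fun i => ζ ^ x i‖ ^ ((2 * k : ℝ) / (k + 1)) := by
  set A := ∑ α ∈ multiIdx n m, ‖q α‖ ^ 2 with hA
  set F : (Fin n → ℕ) → ℝ := fun x => ‖homEval m q fun i => ζ ^ x i‖ with hF
  have hF0 : ∀ x, 0 ≤ F x := fun x => norm_nonneg _
  have hk0 : (0 : ℝ) < k := by exact_mod_cast hk
  have hA0 : 0 ≤ A := by positivity
  have hM0 : (0 : ℝ) < M := by exact_mod_cast (by omega : 0 < M)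
  rcases hA0.eq_or_lt with hA0 | hA0
  · rw [← hA0, Real.zero_rpow (by positivity), mul_zero]
    positivity
  have hN0 : (0 : ℝ) < (M : ℝ) ^ n := by positivity
  set N := (M : ℝ) ^ n
  set E := ∑ x ∈ rootGrid n M, F x ^ ((2 * k : ℝ) / (k + 1)) with hE
  have hE0 : 0 ≤ E := Finset.sum_nonneg fun x _ => Real.rpow_nonneg (hF0 x) _
  have h2 : ∑ x ∈ rootGrid n M, F x ^ 2 = N * A :=
    sum_norm_sq_eq hζ _ (fun α hα i => (le_of_mem_multiIdx hα i).trans_lt (by omega)) q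
  have h4 : ∑ x ∈ rootGrid n M, F x ^ 4 ≤ N * (4 ^ m * A ^ 2) := sum_norm_pow_four_le hζ hM q
  have hpq : Real.HolderConjugate (((k : ℝ) + 2) / (k + 1)) (k + 2) := by
    rw [Real.holderConjugate_iff]
    constructor
    · rw [lt_div_iff₀ (by positivity)]; linarith
    · field_simp; ring
  have hold := Real.inner_le_Lp_mul_Lq_of_nonneg (rootGrid n M)
    (f := fun x => F x ^ ((2 * k : ℝ) / (k + 2))) (g := fun x => F x ^ ((4 : ℝ) / (k + 2))) hpq
    (fun x _ => Real.rpow_nonneg (hF0 x) _) (fun x _ => Real.rpow_nonneg (hF0 x) _)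
  have e1 : ∀ x ∈ rootGrid n M,
      F x ^ ((2 * k : ℝ) / (k + 2)) * F x ^ ((4 : ℝ) / (k + 2)) = F x ^ 2 := by
    intro x _
    rw [← Real.rpow_add_of_nonneg (hF0 x) (by positivity) (by positivity), ← Real.rpow_natCast]
    congr 1
    push_cast
    field_simp; ring
  have e2 : ∀ x ∈ rootGrid n M, (F x ^ ((2 * k : ℝ) / (k + 2))) ^ (((k : ℝ) + 2) / (k + 1))
      = F x ^ ((2 * k : ℝ) / (k + 1)) := by
    intro x _
    rw [← Real.rpow_mul (hF0 x)]
    congr 1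
    field_simp
  have e3 : ∀ x ∈ rootGrid n M, (F x ^ ((4 : ℝ) / (k + 2))) ^ ((k : ℝ) + 2) = F x ^ 4 := by
    intro x _
    rw [← Real.rpow_mul (hF0 x), ← Real.rpow_natCast]
    congr 1
    push_cast
    field_simp
  rw [Finset.sum_congr rfl e1, Finset.sum_congr rfl e2, Finset.sum_congr rfl e3, h2, ← hE] at hold
  have hold' : N * A ≤ E ^ (1 / (((k : ℝ) + 2) / (k + 1))) *
      (N * (4 ^ m * A ^ 2)) ^ (1 / ((k : ℝ) + 2)) := by
    refine hold.trans ?_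
    gcongr
  have hexp : (0 : ℝ) < (k + 2) / (k + 1) := by positivity
  have h5 := Real.rpow_le_rpow (by positivity) hold' hexp.le
  rw [Real.mul_rpow (by positivity) (by positivity), Real.mul_rpow (by positivity) (by positivity),
    ← Real.rpow_mul hE0, one_div_mul_cancel hexp.ne', Real.rpow_one,
    ← Real.rpow_mul (by positivity), Real.mul_rpow (by positivity) (by positivity),
    Real.mul_rpow (by positivity) (by positivity), ← Real.rpow_natCast, ← Real.rpow_natCast,
    ← Real.rpow_mul (by positivity), ← Real.rpow_mul hA0.le] at h5
  have x1 : 1 / ((k : ℝ) + 2) * ((k + 2) / (k + 1)) = 1 / (k + 1) := by field_simp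
  have x2 : ((k : ℝ) + 2) / (k + 1) = 1 + 1 / (k + 1) := by field_simp; ring
  have x3 : ((k : ℝ) + 2) / (k + 1) = k / (k + 1) + ((2 : ℕ) : ℝ) * (1 / (k + 1)) := by
    push_cast; field_simp
  rw [x1] at h5
  have y1 : N ^ (((k : ℝ) + 2) / (k + 1)) = N * N ^ (1 / ((k : ℝ) + 1)) := by
    rw [x2, Real.rpow_add hN0, Real.rpow_one]
  have y2 : A ^ (((k : ℝ) + 2) / (k + 1))
      = A ^ ((k : ℝ) / (k + 1)) * A ^ (((2 : ℕ) : ℝ) * (1 / ((k : ℝ) + 1))) := by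
    rw [x3, Real.rpow_add hA0]
  rw [y1, y2] at h5
  have hp : 0 < N ^ (1 / ((k : ℝ) + 1)) * A ^ (((2 : ℕ) : ℝ) * (1 / ((k : ℝ) + 1))) := by
    positivity
  refine le_of_mul_le_mul_right ?_ hp
  calc _ = _ := by ring
    _ ≤ _ := h5
    _ = _ := by rw [mul_one_div (m : ℝ)]; ring

end RootsOfUnity

lemma homEval_mul {n : ℕ} (m : ℕ) (a : (Fin n → ℕ) → ℂ) (c : ℂ) (z : Fin n → ℂ) :
    homEval m a (fun i => c * z i) = c ^ m * homEval m a z := by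
  rw [homEval, homEval, Finset.mul_sum]
  refine Finset.sum_congr rfl fun α hα => ?_
  simp only [mul_pow, Finset.prod_mul_distrib]
  rw [Finset.prod_pow_eq_pow_sum, mem_multiIdx.1 hα]
  ring

lemma homEval_zero {n : ℕ} (a : (Fin n → ℕ) → ℂ) (z : Fin n → ℂ) : homEval 0 a z = a 0 := by
  simp [homEval, multiIdx]

/-- The coefficient of `y ^ γ`, as a polynomial in `z`, in the part of bidegree `(m - k, k)` of
`P (z + y)`. -/
noncomputable def polarCoeff {n : ℕ} (m k : ℕ) (a : (Fin n → ℕ) → ℂ) (z : Fin n → ℂ)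
    (γ : Fin n → ℕ) : ℂ :=
  homEval (m - k) (fun β => a (γ + β) * ∏ i, ((γ i + β i).choose (γ i) : ℂ)) z

lemma homEval_add_mul {n : ℕ} (m : ℕ) (a : (Fin n → ℕ) → ℂ) (z y : Fin n → ℂ) (t : ℂ) :
    homEval m a (fun i => z i + t * y i)
      = ∑ k ∈ range (m + 1), t ^ k * homEval k (polarCoeff m k a z) y := by
  have hL : homEval m a (fun i => z i + t * y i) =
      ∑ p ∈ (multiIdx n m).sigma fun α => Fintype.piFinset fun i => range (α i + 1),
        a p.1 * ∏ i, ((t * y i) ^ p.2 i * z i ^ (p.1 i - p.2 i) * (p.1 i).choose (p.2 i)) := by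
    rw [homEval, Finset.sum_sigma]
    refine Finset.sum_congr rfl fun α _ => ?_
    dsimp only
    rw [← Finset.mul_sum, ← Finset.prod_univ_sum (fun i => range (α i + 1))
      (fun i g => (t * y i) ^ g * z i ^ (α i - g) * ((α i).choose g : ℂ))]
    congr 1
    refine Finset.prod_congr rfl fun i _ => ?_
    rw [add_comm, add_pow]
  have hR : ∑ k ∈ range (m + 1), t ^ k * homEval k (polarCoeff m k a z) y =
      ∑ p ∈ (range (m + 1)).sigma fun k => multiIdx n k ×ˢ multiIdx n (m - k),
        t ^ p.1 * (a (p.2.1 + p.2.2) * (∏ i, ((p.2.1 i + p.2.2 i).choose (p.2.1 i) : ℂ)) *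
          (∏ i, z i ^ p.2.2 i) * ∏ i, y i ^ p.2.1 i) := by
    rw [Finset.sum_sigma]
    refine Finset.sum_congr rfl fun k _ => ?_
    rw [homEval, Finset.mul_sum, Finset.sum_product]
    refine Finset.sum_congr rfl fun γ _ => ?_
    rw [polarCoeff, homEval, Finset.sum_mul, Finset.mul_sum]
  rw [hL, hR]
  refine Finset.sum_nbij' (fun p => ⟨∑ i, p.2 i, (p.2, p.1 - p.2)⟩)
    (fun p => ⟨p.2.1 + p.2.2, p.2.1⟩) ?_ ?_ ?_ ?_ ?_
  · rintro ⟨α, γ⟩ h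
    simp only [Finset.mem_sigma, mem_multiIdx, Fintype.mem_piFinset, mem_range,
      Finset.mem_product, Nat.lt_succ_iff] at h ⊢
    refine ⟨?_, trivial, ?_⟩
    · rw [← h.1]; exact Finset.sum_le_sum fun i _ => h.2 i
    · rw [← h.1]
      simp only [Pi.sub_apply]
      rw [Finset.sum_tsub_distrib _ fun i _ => h.2 i]
  · rintro ⟨k, γ, β⟩ h
    simp only [Finset.mem_sigma, mem_multiIdx, Fintype.mem_piFinset, mem_range,
      Finset.mem_product, Nat.lt_succ_iff, Pi.add_apply, Finset.sum_add_distrib] at h ⊢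
    refine ⟨by omega, fun i => by omega⟩
  · rintro ⟨α, γ⟩ h
    simp only [Finset.mem_sigma, Fintype.mem_piFinset, mem_range, Nat.lt_succ_iff] at h
    have : γ + (α - γ) = α := add_tsub_cancel_of_le h.2
    simp only [this]
  · rintro ⟨k, γ, β⟩ h
    simp only [Finset.mem_sigma, mem_multiIdx, Finset.mem_product] at h
    obtain ⟨_, rfl, _⟩ := h
    simp
  · rintro ⟨α, γ⟩ h
    simp only [Finset.mem_sigma, Fintype.mem_piFinset, mem_range, Nat.lt_succ_iff] at h
    have h1 : γ + (α - γ) = α := add_tsub_cancel_of_le h.2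
    have h2 : ∀ i, γ i + (α i - γ i) = α i := fun i => congrFun h1 i
    simp only [h1, h2, mul_pow, Finset.prod_mul_distrib, Finset.prod_pow_eq_pow_sum, Pi.sub_apply]
    ring

/-- Cauchy's estimate for the coefficients of a polynomial. -/
lemma norm_coeff_mul_pow_le {m k : ℕ} (hk : k ≤ m) (c : ℕ → ℂ) {r A : ℝ} (hr : 0 ≤ r)
    (h : ∀ t : ℂ, ‖t‖ = r → ‖∑ j ∈ range (m + 1), t ^ j * c j‖ ≤ A) : ‖c k‖ * r ^ k ≤ A := by
  set M := m + 1 with hM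
  obtain ⟨ζ, hζ⟩ : ∃ ζ : ℂ, IsPrimitiveRoot ζ M := ⟨_, Complex.isPrimitiveRoot_exp M (by omega)⟩
  have hn : ‖ζ‖ = 1 := hζ.norm'_eq_one (by omega)
  have hsum : ∑ x ∈ range M, (∑ j ∈ range M, (r * ζ ^ x) ^ j * c j) *
      (starRingEnd ℂ) ((ζ ^ x) ^ k) = M * (c k * r ^ k) := by
    simp only [Finset.sum_mul]
    rw [Finset.sum_comm]
    have : ∀ j ∈ range M, ∑ x ∈ range M, (r * ζ ^ x) ^ j * c j * (starRingEnd ℂ) ((ζ ^ x) ^ k)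
        = if j = k then M * (c k * r ^ k) else 0 := by
      intro j hj
      calc _ = c j * r ^ j * ∑ x ∈ range M, (ζ ^ x) ^ j * (starRingEnd ℂ) ((ζ ^ x) ^ k) := by
            rw [Finset.mul_sum]
            refine Finset.sum_congr rfl fun x _ => ?_
            rw [mul_pow]; ring
        _ = _ := by
            rw [sum_pow_mul_conj hζ (mem_range.1 hj) (by omega)]
            split_ifs with h
            · subst h; ring
            · simp
    rw [Finset.sum_congr rfl this, Finset.sum_ite_eq', if_pos (mem_range.2 (by omega))]
  have hle : (M : ℝ) * (‖c k‖ * r ^ k) ≤ M * A := by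
    calc (M : ℝ) * (‖c k‖ * r ^ k) = ‖(M : ℂ) * (c k * r ^ k)‖ := by
          simp [abs_of_nonneg hr]
      _ ≤ ∑ x ∈ range M, A := by
          rw [← hsum]
          refine (norm_sum_le _ _).trans (Finset.sum_le_sum fun x _ => ?_)
          rw [norm_mul, RCLike.norm_conj, norm_pow, norm_pow, hn]
          simp only [one_pow, mul_one]
          exact h _ (by simp [hn, abs_of_nonneg hr])
      _ = M * A := by simp
  exact le_of_mul_le_mul_left hle (by positivity)

/-- Polarization estimate for the part of bidegree `(m - k, k)` of `P (z + y)`. -/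
lemma norm_homEval_polarCoeff_le {n m k : ℕ} (hm : 1 ≤ m) (hk : k ≤ m) (a : (Fin n → ℕ) → ℂ)
    (h : ∀ z : Fin n → ℂ, (∀ i, ‖z i‖ ≤ 1) → ‖homEval m a z‖ ≤ 1) {z y : Fin n → ℂ}
    (hz : ∀ i, ‖z i‖ ≤ 1) (hy : ∀ i, ‖y i‖ ≤ 1) :
    ‖homEval k (polarCoeff m k a z) y‖ ≤ 3 * (m : ℝ) ^ k := by
  have hm0 : (0 : ℝ) < m := by exact_mod_cast hm
  have key := norm_coeff_mul_pow_le hk (fun k => homEval k (polarCoeff m k a z) y)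
    (r := 1 / m) (A := 3) (by positivity) ?_
  · rw [one_div, inv_pow, ← div_eq_mul_inv, div_le_iff₀ (by positivity)] at key
    exact key
  · intro t ht
    rw [← homEval_add_mul]
    have hs : (0 : ℝ) < 1 + 1 / m := by positivity
    have hsc : ((1 + 1 / m : ℝ) : ℂ) ≠ 0 := by exact_mod_cast hs.ne'
    have : (fun i => z i + t * y i) =
        fun i => ((1 + 1 / m : ℝ) : ℂ) * ((z i + t * y i) / ((1 + 1 / m : ℝ) : ℂ)) := by
      funext i
      rw [mul_div_cancel₀ _ hsc]
    rw [this, homEval_mul, norm_mul, norm_pow, Complex.norm_real, Real.norm_of_nonneg hs.le]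
    have h1 : (1 + 1 / (m : ℝ)) ^ m ≤ 3 := by
      calc (1 + 1 / (m : ℝ)) ^ m ≤ Real.exp (1 / m) ^ m := by
            gcongr
            rw [add_comm]
            exact Real.add_one_le_exp _
        _ = Real.exp 1 := by rw [← Real.exp_nat_mul]; congr 1; field_simp
        _ ≤ 3 := Real.exp_one_lt_three.le
    have h2 : ‖homEval m a fun i => (z i + t * y i) / ((1 + 1 / m : ℝ) : ℂ)‖ ≤ 1 := by
      refine h _ fun i => ?_
      rw [norm_div, Complex.norm_real, Real.norm_of_nonneg hs.le, div_le_one hs]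
      calc ‖z i + t * y i‖ ≤ ‖z i‖ + ‖t‖ * ‖y i‖ := by
            rw [← norm_mul]; exact norm_add_le _ _
        _ ≤ 1 + 1 / m * 1 := by rw [ht]; gcongr; exacts [hz i, hy i]
        _ = _ := by ring
    calc _ ≤ 3 * (1 : ℝ) := by gcongr
      _ = 3 := by ring

/-- Complexification: a bound on the real cube gives a bound on the polydisc. -/
lemma norm_homEval_le_of_real {n m : ℕ} (a : (Fin n → ℕ) → ℂ) {S : ℝ}
    (h : ∀ x : Fin n → ℝ, (∀ i, |x i| ≤ 1) → ‖homEval m a fun i => (x i : ℂ)‖ ≤ S)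
    {z : Fin n → ℂ} (hz : ∀ i, ‖z i‖ ≤ 1) : ‖homEval m a z‖ ≤ 2 ^ m * S := by
  have key := norm_coeff_mul_pow_le (le_refl m)
    (fun k => homEval k (polarCoeff m k a fun i => 1 / 2 * (starRingEnd ℂ) (z i))
      fun i => 1 / 2 * z i) (r := 1) (A := S) zero_le_one ?_
  · rw [homEval_mul] at key
    have : homEval m (polarCoeff m m a fun i => 1 / 2 * (starRingEnd ℂ) (z i)) z
        = homEval m a z := by
      refine Finset.sum_congr rfl fun α _ => ?_
      rw [polarCoeff, Nat.sub_self, homEval_zero]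
      simp
    rw [this, norm_mul] at key
    simp only [one_div, norm_pow, norm_inv, Complex.norm_ofNat, one_pow, mul_one, inv_pow] at key
    rwa [inv_mul_le_iff₀ (by positivity)] at key
  · intro t ht
    rw [← homEval_add_mul]
    obtain ⟨s, rfl⟩ : ∃ s : ℂ, s ^ 2 = t := IsAlgClosed.exists_pow_nat_eq t (by norm_num)
    have hs : ‖s‖ = 1 := by
      rw [norm_pow] at ht
      exact (pow_eq_one_iff_of_nonneg (norm_nonneg _) two_ne_zero).1 ht
    have hs1 : s * (starRingEnd ℂ) s = 1 := by
      rw [Complex.mul_conj, Complex.normSq_eq_norm_sq, hs]; simp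
    have : (fun i => 1 / 2 * (starRingEnd ℂ) (z i) + s ^ 2 * (1 / 2 * z i)) =
        fun i => s * ((s * z i).re : ℂ) := by
      funext i
      rw [Complex.re_eq_add_conj, map_mul]
      linear_combination (-1 / 2 * (starRingEnd ℂ) (z i)) * hs1
    rw [this, homEval_mul, norm_mul, norm_pow, hs, one_pow, one_mul]
    refine h _ fun i => (Complex.abs_re_le_norm _).trans ?_
    rw [norm_mul, hs, one_mul]
    exact hz i

/-- `D` bounds the `2m/(m+1)`-th power sum of the coefficients of every `m`-homogeneous complex
polynomial which is bounded by one on the unit polydisc. -/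
def PolydiscBH (m : ℕ) (D : ℝ) : Prop :=
  ∀ (n : ℕ) (a : (Fin n → ℕ) → ℂ),
    (∀ z : Fin n → ℂ, (∀ i, ‖z i‖ ≤ 1) → ‖homEval m a z‖ ≤ 1) →
      ∑ α ∈ multiIdx n m, ‖a α‖ ^ ((2 * m : ℝ) / (m + 1)) ≤ D

lemma PolydiscBH.nonneg {m : ℕ} {D : ℝ} (h : PolydiscBH m D) : 0 ≤ D :=
  (Finset.sum_nonneg fun _ _ => by positivity).trans (h 0 0 (by simp [homEval]))

lemma PolydiscBH.mono {m : ℕ} {D D' : ℝ} (h : PolydiscBH m D) (hD : D ≤ D') : PolydiscBH m D' :=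
  fun n a ha => (h n a ha).trans hD

lemma PolydiscBH.sum_le {m : ℕ} {D : ℝ} (h : PolydiscBH m D) {n : ℕ} {a : (Fin n → ℕ) → ℂ} {T : ℝ}
    (hT : 0 < T) (ha : ∀ z : Fin n → ℂ, (∀ i, ‖z i‖ ≤ 1) → ‖homEval m a z‖ ≤ T) :
    ∑ α ∈ multiIdx n m, ‖a α‖ ^ ((2 * m : ℝ) / (m + 1)) ≤ D * T ^ ((2 * m : ℝ) / (m + 1)) := by
  have h1 := h n (fun α => a α / T) fun z hz => by
    have : homEval m (fun α => a α / T) z = homEval m a z / T := by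
      rw [homEval, homEval, Finset.sum_div]
      exact Finset.sum_congr rfl fun α _ => by ring
    rw [this, norm_div, Complex.norm_real, Real.norm_of_nonneg hT.le, div_le_one hT]
    exact ha z hz
  simp only [norm_div, Complex.norm_real, Real.norm_of_nonneg hT.le] at h1
  rw [Finset.sum_congr rfl fun α _ => Real.div_rpow (norm_nonneg (a α)) hT.le _,
    ← Finset.sum_div, div_le_iff₀ (Real.rpow_pos_of_pos hT _)] at h1
  exact h1

/-- A mixed norm estimate for the coefficients, by averaging the inequality of lower degree. -/
lemma PolydiscBH.mixed_sum_le {m k : ℕ} {D : ℝ} (h : PolydiscBH k D) (hk : 1 ≤ k) (hkm : k ≤ m)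
    {n : ℕ} (a : (Fin n → ℕ) → ℂ)
    (ha : ∀ z : Fin n → ℂ, (∀ i, ‖z i‖ ≤ 1) → ‖homEval m a z‖ ≤ 1) :
    ∑ γ ∈ multiIdx n k, (∑ β ∈ multiIdx n (m - k), ‖a (γ + β)‖ ^ 2) ^ ((k : ℝ) / (k + 1))
      ≤ (4 : ℝ) ^ ((m : ℝ) / (k + 1)) * (9 * (m : ℝ) ^ (2 * k) * D) := by
  have hD := h.nonneg
  have hm1 : (1 : ℝ) ≤ m := by exact_mod_cast hk.trans hkm
  set M := 2 * m + 1 with hM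
  obtain ⟨ζ, hζ⟩ : ∃ ζ : ℂ, IsPrimitiveRoot ζ M := ⟨_, Complex.isPrimitiveRoot_exp M (by omega)⟩
  have hn : ‖ζ‖ = 1 := hζ.norm'_eq_one (by omega)
  have hN : (0 : ℝ) < (M : ℝ) ^ n := by positivity
  set N : ℝ := (M : ℝ) ^ n with hNdef
  set p : ℝ := (2 * k : ℝ) / (k + 1) with hp
  have hp2 : p ≤ 2 := by
    rw [hp, div_le_iff₀ (by positivity)]; linarith
  have hpoint : ∀ x ∈ rootGrid n M,
      ∑ γ ∈ multiIdx n k, ‖polarCoeff m k a (fun i => ζ ^ x i) γ‖ ^ p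
        ≤ 9 * (m : ℝ) ^ (2 * k) * D := by
    intro x _
    have hT : (1 : ℝ) ≤ 3 * (m : ℝ) ^ k := by
      have := one_le_pow₀ (n := k) hm1; linarith
    refine (h.sum_le (by linarith) fun y hy => norm_homEval_polarCoeff_le (hk.trans hkm) hkm a ha
      (fun i => by rw [norm_pow, hn, one_pow]) hy).trans ?_
    calc D * (3 * (m : ℝ) ^ k) ^ p ≤ D * (3 * (m : ℝ) ^ k) ^ (2 : ℝ) := by
          gcongr
      _ = 9 * (m : ℝ) ^ (2 * k) * D := by
          rw [Real.rpow_two]; ring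
  refine le_of_mul_le_mul_left ?_ hN
  calc N * ∑ γ ∈ multiIdx n k, (∑ β ∈ multiIdx n (m - k), ‖a (γ + β)‖ ^ 2) ^ ((k : ℝ) / (k + 1))
      ≤ ∑ γ ∈ multiIdx n k, (4 : ℝ) ^ ((m : ℝ) / (k + 1)) *
          ∑ x ∈ rootGrid n M, ‖polarCoeff m k a (fun i => ζ ^ x i) γ‖ ^ p := by
        rw [Finset.mul_sum]
        refine Finset.sum_le_sum fun γ _ => ?_
        have h1 := sum_norm_sq_rpow_le (m := m - k) hk hζ (by omega)
          fun β => a (γ + β) * ∏ i, ((γ i + β i).choose (γ i) : ℂ)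
        have h2 : (4 : ℝ) ^ (((m - k : ℕ) : ℝ) / (k + 1)) ≤ (4 : ℝ) ^ ((m : ℝ) / (k + 1)) := by
          gcongr
          · norm_num
          · omega
        refine le_trans ?_ (h1.trans ?_)
        · gcongr with β _
          rw [norm_mul]
          refine le_mul_of_one_le_right (norm_nonneg _) ?_
          have : 1 ≤ ∏ i, (γ i + β i).choose (γ i) :=
            Finset.one_le_prod' fun i _ => Nat.choose_pos (Nat.le_add_right _ _)
          rw [← Nat.cast_prod, Complex.norm_natCast]
          exact_mod_cast this
        · exact mul_le_mul_of_nonneg_right h2 (Finset.sum_nonneg fun x _ => by positivity)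
    _ = (4 : ℝ) ^ ((m : ℝ) / (k + 1)) * ∑ x ∈ rootGrid n M,
          ∑ γ ∈ multiIdx n k, ‖polarCoeff m k a (fun i => ζ ^ x i) γ‖ ^ p := by
        rw [← Finset.mul_sum, Finset.sum_comm]
    _ ≤ (4 : ℝ) ^ ((m : ℝ) / (k + 1)) * ∑ x ∈ rootGrid n M, 9 * (m : ℝ) ^ (2 * k) * D := by
        gcongr with x hx
        exact hpoint x hx
    _ = _ := by
        rw [Finset.sum_const, Fintype.card_piFinset]
        simp only [card_range, Finset.prod_const, Finset.card_univ, Fintype.card_fin, nsmul_eq_mul]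
        push_cast
        ring

lemma exists_le_sum_eq {n k : ℕ} (α : Fin n → ℕ) (h : k ≤ ∑ i, α i) :
    ∃ γ ≤ α, ∑ i, γ i = k := by
  induction k with
  | zero => exact ⟨0, fun i => Nat.zero_le _, by simp⟩
  | succ k ih =>
    obtain ⟨γ, hγ, hk⟩ := ih (by omega)
    obtain ⟨i, -, hi⟩ : ∃ i ∈ univ, γ i < α i := Finset.exists_lt_of_sum_lt (by omega)
    refine ⟨γ + Pi.single i 1, fun j => ?_, ?_⟩
    · rcases eq_or_ne j i with rfl | hj
      · simpa using hi
      · simpa [hj] using hγ j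
    · simp [Finset.sum_add_distrib, hk]

lemma exists_sum_eq {J : Type*} [DecidableEq J] {n : ℕ} (kk : J → ℕ) (s : Finset J)
    (α : Fin n → ℕ) (h : ∑ i, α i = ∑ j ∈ s, kk j) :
    ∃ c : J → Fin n → ℕ, (∀ j ∈ s, c j ∈ multiIdx n (kk j)) ∧ ∑ j ∈ s, c j = α := by
  induction s using Finset.induction_on generalizing α with
  | empty =>
    refine ⟨0, by simp, ?_⟩
    funext i
    simp only [Finset.sum_empty, Finset.sum_eq_zero_iff, Finset.mem_univ, true_imp_iff] at h
    simp [h i]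
  | insert j s hj ih =>
    rw [Finset.sum_insert hj] at h
    obtain ⟨γ, hγ, hk⟩ := exists_le_sum_eq α (k := kk j) (by omega)
    obtain ⟨c, hc, hs⟩ := ih (α - γ) (by
      simp only [Pi.sub_apply]
      rw [Finset.sum_tsub_distrib _ fun i _ => hγ i]
      omega)
    have hne : ∀ l ∈ s, Function.update c j γ l = c l := fun l hl =>
      Function.update_of_ne (by rintro rfl; exact hj hl) _ _
    refine ⟨Function.update c j γ, ?_, ?_⟩
    · intro l hl
      rcases Finset.mem_insert.1 hl with rfl | hl
      · rw [Function.update_self]; exact mem_multiIdx.2 hk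
      · rw [hne l hl]; exact hc l hl
    · rw [Finset.sum_insert hj, Function.update_self, Finset.sum_congr rfl hne, hs]
      exact add_tsub_cancel_of_le hγ

/-- Interpolation of mixed norms over the blocks of a composition of the degree. -/
lemma sum_rpow_le_of_mixed {J : Type*} [Fintype J] [DecidableEq J] {n m : ℕ} (hm : 1 ≤ m)
    (kk : J → ℕ) (hkk : ∀ j, 1 ≤ kk j) (hsum : ∑ j, kk j = m) (f : (Fin n → ℕ) → ℝ)
    (hf : ∀ α, 0 ≤ f α)
    {K : ℝ} (hK : 1 ≤ K)
    (h : ∀ j, ∑ γ ∈ multiIdx n (kk j),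
      (∑ β ∈ multiIdx n (m - kk j), f (γ + β) ^ 2) ^ ((kk j : ℝ) / (kk j + 1)) ≤ K) :
    ∑ α ∈ multiIdx n m, f α ^ ((2 * m : ℝ) / (m + 1)) ≤ K ^ 2 := by
  set A : J → (Fin n → ℕ) → ℝ := fun j γ => ∑ β ∈ multiIdx n (m - kk j), f (γ + β) ^ 2 with hA
  have hA0 : ∀ j γ, 0 ≤ A j γ := fun j γ => Finset.sum_nonneg fun _ _ => sq_nonneg _
  have hK0 : 0 < K := by linarith
  have hdec : ∀ α : Fin n → ℕ, ∃ c : J → Fin n → ℕ, α ∈ multiIdx n m →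
      (∀ j, c j ∈ multiIdx n (kk j)) ∧ ∑ j, c j = α := by
    intro α
    by_cases hα : α ∈ multiIdx n m
    · obtain ⟨c, hc⟩ := exists_sum_eq kk univ α (by rw [hsum]; exact mem_multiIdx.1 hα)
      exact ⟨c, fun _ => ⟨fun j => hc.1 j (Finset.mem_univ j), hc.2⟩⟩
    · exact ⟨0, fun h => absurd h hα⟩
  choose c hc using hdec
  have hcle : ∀ α ∈ multiIdx n m, ∀ j, c α j ≤ α := by
    intro α hα j i
    have := congrFun (hc α hα).2 i
    rw [Finset.sum_apply] at this
    rw [← this]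
    exact Finset.single_le_sum (f := fun j => c α j i) (fun _ _ => Nat.zero_le _)
      (Finset.mem_univ j)
  have hcsub : ∀ α ∈ multiIdx n m, ∀ j, α - c α j ∈ multiIdx n (m - kk j) := by
    intro α hα j
    rw [mem_multiIdx]
    simp only [Pi.sub_apply]
    rw [Finset.sum_tsub_distrib _ fun i _ => hcle α hα j i, mem_multiIdx.1 hα,
      mem_multiIdx.1 ((hc α hα).1 j)]
  set X : J → (Fin n → ℕ) → ℝ := fun j α => f α ^ 2 * A j (c α j) ^ (-(1 : ℝ) / (kk j + 1)) with hX
  set Y : (Fin n → ℕ) → ℝ := fun α => ∏ j, A j (c α j) ^ ((kk j : ℝ) / (kk j + 1)) with hY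
  have hX0 : ∀ j α, 0 ≤ X j α := fun j α => mul_nonneg (sq_nonneg _) (Real.rpow_nonneg (hA0 _ _) _)
  have hY0 : ∀ α, 0 ≤ Y α := fun α => Finset.prod_nonneg fun j _ => Real.rpow_nonneg (hA0 _ _) _
  have hXsum : ∀ j, ∑ α ∈ multiIdx n m, X j α ≤ K := by
    intro j
    refine le_trans ?_ (h j)
    set G : (Fin n → ℕ) × (Fin n → ℕ) → ℝ :=
      fun p => f (p.1 + p.2) ^ 2 * A j p.1 ^ (-(1 : ℝ) / (kk j + 1)) with hG
    calc ∑ α ∈ multiIdx n m, X j α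
        = ∑ α ∈ multiIdx n m, G (c α j, α - c α j) := by
          refine Finset.sum_congr rfl fun α hα => ?_
          simp only [hG, hX]
          rw [add_tsub_cancel_of_le (hcle α hα j)]
      _ = ∑ p ∈ (multiIdx n m).image fun α => (c α j, α - c α j), G p := by
          rw [Finset.sum_image]
          intro α hα β hβ hab
          have h1 := add_tsub_cancel_of_le (hcle α hα j)
          have h2 := add_tsub_cancel_of_le (hcle β hβ j)
          simp only [Prod.mk.injEq] at hab
          rw [← h1, ← h2, hab.2, hab.1]
      _ ≤ ∑ p ∈ multiIdx n (kk j) ×ˢ multiIdx n (m - kk j), G p := by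
          refine Finset.sum_le_sum_of_subset_of_nonneg ?_ fun p _ _ =>
            mul_nonneg (sq_nonneg _) (Real.rpow_nonneg (hA0 _ _) _)
          intro p hp
          obtain ⟨α, hα, rfl⟩ := Finset.mem_image.1 hp
          exact Finset.mem_product.2 ⟨(hc α hα).1 j, hcsub α hα j⟩
      _ = ∑ γ ∈ multiIdx n (kk j), A j γ * A j γ ^ (-(1 : ℝ) / (kk j + 1)) := by
          rw [Finset.sum_product]
          refine Finset.sum_congr rfl fun γ _ => ?_
          simp only [hG]
          rw [← Finset.sum_mul]
      _ = ∑ γ ∈ multiIdx n (kk j), A j γ ^ ((kk j : ℝ) / (kk j + 1)) := by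
          refine Finset.sum_congr rfl fun γ _ => ?_
          have hkj : (0 : ℝ) < kk j := by exact_mod_cast hkk j
          rcases (hA0 j γ).eq_or_lt with h0 | h0
          · rw [← h0, zero_mul, Real.zero_rpow (by positivity)]
          · rw [← Real.rpow_one_add' h0.le]
            · congr 1; field_simp; ring
            · have : 1 + -(1 : ℝ) / (kk j + 1) = kk j / (kk j + 1) := by field_simp; ring
              rw [this]; positivity
  set b := Fintype.card J with hb
  have hYsum : ∑ α ∈ multiIdx n m, Y α ≤ K ^ b := by
    set H : (J → Fin n → ℕ) → ℝ := fun γ => ∏ j, A j (γ j) ^ ((kk j : ℝ) / (kk j + 1)) with hH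
    calc ∑ α ∈ multiIdx n m, Y α = ∑ α ∈ multiIdx n m, H (c α) := rfl
      _ = ∑ γ ∈ (multiIdx n m).image c, H γ := by
          rw [Finset.sum_image]
          intro α hα β hβ hab
          rw [← (hc α hα).2, ← (hc β hβ).2, hab]
      _ ≤ ∑ γ ∈ Fintype.piFinset fun j => multiIdx n (kk j), H γ := by
          refine Finset.sum_le_sum_of_subset_of_nonneg ?_ fun γ _ _ =>
            Finset.prod_nonneg fun j _ => Real.rpow_nonneg (hA0 _ _) _
          intro γ hγ
          obtain ⟨α, hα, rfl⟩ := Finset.mem_image.1 hγ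
          exact Fintype.mem_piFinset.2 (hc α hα).1
      _ = ∏ j, ∑ γ ∈ multiIdx n (kk j), A j γ ^ ((kk j : ℝ) / (kk j + 1)) :=
          (Finset.prod_univ_sum (fun j => multiIdx n (kk j))
            fun j γ => A j γ ^ ((kk j : ℝ) / (kk j + 1))).symm
      _ ≤ ∏ _j : J, K := Finset.prod_le_prod
          (fun j _ => Finset.sum_nonneg fun γ _ => Real.rpow_nonneg (hA0 _ _) _) fun j _ => h j
      _ = K ^ b := by simp [hb]
  have hm1 : (0 : ℝ) < (m : ℝ) + 1 := by positivity
  have hbm : b ≤ m := by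
    rw [hb, ← hsum, ← Finset.card_univ, Finset.card_eq_sum_ones]
    exact Finset.sum_le_sum fun j _ => hkk j
  have hsumR : ∑ j, (kk j : ℝ) / (m + 1) = m / (m + 1) := by
    rw [← Finset.sum_div, ← hsum]; push_cast; rfl
  have hpoint : ∀ α ∈ multiIdx n m, f α ^ ((2 * m : ℝ) / (m + 1)) ≤
      K ^ 2 * (∑ j, (kk j : ℝ) / (m + 1) * (X j α / K) + 1 / (m + 1) * (Y α / K ^ b)) := by
    intro α hα
    have hR0 : 0 ≤ ∑ j, (kk j : ℝ) / (m + 1) * (X j α / K) + 1 / (m + 1) * (Y α / K ^ b) := by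
      have := hY0 α
      have : 0 ≤ ∑ j, (kk j : ℝ) / (m + 1) * (X j α / K) := Finset.sum_nonneg fun j _ => by
        have := hX0 j α
        positivity
      positivity
    rcases (hf α).eq_or_lt with h0 | h0
    · rw [← h0, Real.zero_rpow (by positivity)]
      positivity
    have hApos : ∀ j, 0 < A j (c α j) := by
      intro j
      refine lt_of_lt_of_le (pow_pos h0 2) ?_
      have := Finset.single_le_sum (f := fun β => f (c α j + β) ^ 2) (fun _ _ => sq_nonneg _)
        (hcsub α hα j)
      simpa only [add_tsub_cancel_of_le (hcle α hα j)] using this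
    have hXpos : ∀ j, 0 < X j α := fun j =>
      mul_pos (pow_pos h0 2) (Real.rpow_pos_of_pos (hApos j) _)
    have hYpos : 0 < Y α := Finset.prod_pos fun j _ => Real.rpow_pos_of_pos (hApos j) _
    have amgm := Real.geom_mean_le_arith_mean_weighted (univ : Finset (Option J))
      (fun o => o.elim ((1 : ℝ) / (m + 1)) fun j => (kk j : ℝ) / (m + 1))
      (fun o => o.elim (Y α / K ^ b) fun j => X j α / K)
      (by
        rintro (_ | j) -
        · simp only [Option.elim]; positivity
        · simp only [Option.elim]; positivity)
      (by
        rw [Fintype.sum_option]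
        simp only [Option.elim]
        rw [hsumR]; field_simp; ring)
      (by
        rintro (_ | j) -
        · simp only [Option.elim]; positivity
        · have := hXpos j
          simp only [Option.elim]; positivity)
    rw [Fintype.prod_option, Fintype.sum_option] at amgm
    simp only [Option.elim] at amgm
    rw [add_comm (1 / ((m : ℝ) + 1) * (Y α / K ^ b))] at amgm
    refine le_trans ?_ (mul_le_mul_of_nonneg_left amgm (sq_nonneg K))
    have e1 : ∀ j, (X j α / K) ^ ((kk j : ℝ) / (m + 1)) = f α ^ (2 * ((kk j : ℝ) / (m + 1))) *
        (A j (c α j) ^ ((kk j : ℝ) / (kk j + 1) * (1 / (m + 1))))⁻¹ *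
        (K ^ ((kk j : ℝ) / (m + 1)))⁻¹ := by
      intro j
      rw [Real.div_rpow (hXpos j).le hK0.le, Real.mul_rpow (sq_nonneg _)
        (Real.rpow_nonneg (hA0 _ _) _), ← Real.rpow_natCast, ← Real.rpow_mul h0.le,
        ← Real.rpow_mul (hA0 _ _), div_eq_mul_inv]
      congr 2
      rw [← Real.rpow_neg (hA0 _ _)]
      congr 1
      field_simp
    have e2 : (Y α / K ^ b) ^ ((1 : ℝ) / (m + 1)) =
        (∏ j, A j (c α j) ^ ((kk j : ℝ) / (kk j + 1) * (1 / (m + 1)))) *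
          (K ^ ((b : ℝ) / (m + 1)))⁻¹ := by
      rw [Real.div_rpow hYpos.le (by positivity), hY,
        ← Real.finsetProd_rpow _ _ fun j _ => Real.rpow_nonneg (hA0 _ _) _, div_eq_mul_inv,
        ← Real.rpow_natCast, ← Real.rpow_mul hK0.le, mul_one_div]
      congr 1
      exact Finset.prod_congr rfl fun j _ => by rw [← Real.rpow_mul (hA0 _ _)]
    have e3 : ∏ j, f α ^ (2 * ((kk j : ℝ) / (m + 1))) = f α ^ ((2 * m : ℝ) / (m + 1)) := by
      rw [← Real.rpow_sum_of_pos h0, ← Finset.mul_sum, hsumR, mul_div_assoc]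
    have e4 : ∏ j, (K ^ ((kk j : ℝ) / (m + 1)))⁻¹ = (K ^ ((m : ℝ) / (m + 1)))⁻¹ := by
      rw [Finset.prod_inv_distrib, ← Real.rpow_sum_of_pos hK0, hsumR]
    rw [Finset.prod_congr rfl fun j _ => e1 j, e2, Finset.prod_mul_distrib,
      Finset.prod_mul_distrib, e3, e4, Finset.prod_inv_distrib]
    have hPpos : 0 < ∏ j, A j (c α j) ^ ((kk j : ℝ) / (kk j + 1) * (1 / (m + 1))) :=
      Finset.prod_pos fun j _ => Real.rpow_pos_of_pos (hApos j) _
    have hKK : K ^ ((m : ℝ) / (m + 1)) * K ^ ((b : ℝ) / (m + 1)) ≤ K ^ 2 := by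
      rw [← Real.rpow_add hK0, ← Real.rpow_natCast]
      refine Real.rpow_le_rpow_of_exponent_le hK ?_
      rw [← add_div, div_le_iff₀ hm1]
      have : (b : ℝ) ≤ m := by exact_mod_cast hbm
      push_cast
      linarith
    have hK1 : 0 < K ^ ((m : ℝ) / (m + 1)) := by positivity
    have hK2 : 0 < K ^ ((b : ℝ) / (m + 1)) := by positivity
    have hf1 : 0 < f α ^ ((2 * m : ℝ) / (m + 1)) := by positivity
    set P := ∏ j, A j (c α j) ^ ((kk j : ℝ) / (kk j + 1) * (1 / (m + 1)))
    set F := f α ^ ((2 * m : ℝ) / (m + 1))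
    set K1 := K ^ ((m : ℝ) / (m + 1))
    set K2 := K ^ ((b : ℝ) / (m + 1))
    have : K ^ 2 * (P * K2⁻¹ * (F * P⁻¹ * K1⁻¹)) = F * (K ^ 2 / (K1 * K2)) := by
      field_simp
    rw [this]
    exact le_mul_of_one_le_right hf1.le ((one_le_div (by positivity)).2 hKK)
  refine (Finset.sum_le_sum hpoint).trans ?_
  rw [← Finset.mul_sum]
  refine mul_le_of_le_one_right (sq_nonneg K) ?_
  rw [Finset.sum_add_distrib, Finset.sum_comm, ← Finset.mul_sum, ← Finset.sum_div]
  have h1 : ∀ j, ∑ α ∈ multiIdx n m, (kk j : ℝ) / (m + 1) * (X j α / K) ≤ (kk j : ℝ) / (m + 1) := by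
    intro j
    rw [← Finset.mul_sum, ← Finset.sum_div]
    exact mul_le_of_le_one_right (by positivity) ((div_le_one hK0).2 (hXsum j))
  calc _ ≤ ∑ j, (kk j : ℝ) / (m + 1) + 1 / (m + 1) * 1 := by
        refine add_le_add (Finset.sum_le_sum fun j _ => h1 j) ?_
        gcongr
        exact (div_le_one (by positivity)).2 hYsum
    _ = 1 := by rw [hsumR]; field_simp

lemma multiIdx_one (n : ℕ) : multiIdx n 1 = univ.image fun i => Pi.single i 1 := by
  ext α
  simp only [mem_multiIdx, Finset.mem_image, Finset.mem_univ, true_and]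
  constructor
  · intro h
    obtain ⟨i, -, hi⟩ := Finset.exists_ne_zero_of_sum_ne_zero (s := univ) (f := α) (by omega)
    refine ⟨i, ?_⟩
    funext j
    rw [← Finset.add_sum_erase _ _ (Finset.mem_univ i)] at h
    rcases eq_or_ne j i with rfl | hj
    · simp only [Pi.single_eq_same]; omega
    · have : ∑ l ∈ univ.erase i, α l = 0 := by omega
      rw [Finset.sum_eq_zero_iff] at this
      rw [Pi.single_eq_of_ne hj, this j (by simp [hj])]
  · rintro ⟨i, rfl⟩
    simp

lemma polydiscBH_one : PolydiscBH 1 1 := by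
  intro n a ha
  have hinj : Set.InjOn (fun i : Fin n => (Pi.single i 1 : Fin n → ℕ)) (univ : Finset (Fin n)) :=
    fun i _ j _ h => by
      by_contra hij
      have := congrFun h i
      simp [Pi.single_eq_of_ne hij] at this
  have hev : ∀ z : Fin n → ℂ, homEval 1 a z = ∑ i, a (Pi.single i 1) * z i := by
    intro z
    rw [homEval, multiIdx_one, Finset.sum_image hinj]
    refine Finset.sum_congr rfl fun i _ => ?_
    rw [Finset.prod_eq_single i]
    · simp
    · intro j _ hj
      simp [Pi.single_eq_of_ne hj]
    · simp
  rw [multiIdx_one, Finset.sum_image hinj]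
  norm_num only [Nat.cast_one, mul_one, Real.rpow_one]
  have hphase : ∀ w : ℂ, ∃ u : ℂ, ‖u‖ ≤ 1 ∧ w * u = ‖w‖ := by
    intro w
    rcases eq_or_ne w 0 with rfl | hw
    · exact ⟨0, by simp, by simp⟩
    · refine ⟨(starRingEnd ℂ) w / ‖w‖, ?_, ?_⟩
      · rw [norm_div, RCLike.norm_conj, Complex.norm_real, norm_norm]
        exact div_self_le_one _
      · have : (‖w‖ : ℂ) ≠ 0 := by simpa using hw
        rw [← mul_div_assoc, Complex.mul_conj, Complex.normSq_eq_norm_sq]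
        push_cast
        field_simp
  choose u hu1 hu2 using hphase
  have := ha (fun i => u (a (Pi.single i 1))) fun i => hu1 _
  rw [hev] at this
  simp only [hu2] at this
  rw [← Complex.ofReal_sum, Complex.norm_real] at this
  exact (le_abs_self _).trans this

/-- Deduction of the inequality in degree `m` from the degrees of the parts of a composition
of `m`. -/
lemma polydiscBH_of_composition {J : Type*} [Fintype J] [DecidableEq J] {m k l : ℕ} (hm : 1 ≤ m)
    (kk : J → ℕ) (hk : 1 ≤ k) (hkk : ∀ j, k ≤ kk j) (hl : ∀ j, kk j ≤ l) (hsum : ∑ j, kk j = m)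
    {D : ℝ} (hD : 1 ≤ D) (h : ∀ j, PolydiscBH (kk j) D) :
    PolydiscBH m (((4 : ℝ) ^ ((m : ℝ) / (k + 1)) * (9 * (m : ℝ) ^ (2 * l) * D)) ^ 2) := by
  intro n a ha
  have hm1 : (1 : ℝ) ≤ m := by exact_mod_cast hm
  refine sum_rpow_le_of_mixed hm kk (fun j => hk.trans (hkk j)) hsum (fun α => ‖a α‖)
    (fun α => norm_nonneg _) ?_ fun j => ?_
  · have h1 : (1 : ℝ) ≤ (4 : ℝ) ^ ((m : ℝ) / (k + 1)) :=
      Real.one_le_rpow (by norm_num) (by positivity)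
    have h2 := one_le_pow₀ (n := 2 * l) hm1
    exact one_le_mul_of_one_le_of_one_le h1 (one_le_mul_of_one_le_of_one_le (by linarith) hD)
  · refine ((h j).mixed_sum_le (hk.trans (hkk j)) ?_ a ha).trans ?_
    · rw [← hsum]
      exact Finset.single_le_sum (fun _ _ => Nat.zero_le _) (Finset.mem_univ j)
    · gcongr
      · norm_num
      · exact hkk j
      · exact hl j

lemma exists_polydiscBH {m : ℕ} (hm : 1 ≤ m) : ∃ D : ℝ, PolydiscBH m D :=
  ⟨_, polydiscBH_of_composition hm (fun _ : Fin m => 1) le_rfl (fun _ => le_rfl) (fun _ => le_rfl)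
    (by simp) le_rfl fun _ => polydiscBH_one⟩

/-- Subexponential growth of the constants on the polydisc. -/
lemma exists_polydiscBH_growth {k : ℕ} (hk : 1 ≤ k) :
    ∃ C : ℝ, 1 ≤ C ∧ ∀ m : ℕ, k ≤ m →
      PolydiscBH m (((4 : ℝ) ^ ((m : ℝ) / (k + 1)) * (9 * (m : ℝ) ^ (2 * (2 * k)) * C)) ^ 2) := by
  have hex : ∀ i : ℕ, ∃ D : ℝ, 1 ≤ i → PolydiscBH i D := fun i => by
    by_cases hi : 1 ≤ i
    · exact (exists_polydiscBH hi).imp fun _ hD _ => hD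
    · exact ⟨0, fun h => absurd h hi⟩
  choose D hD using hex
  have hC0 : 0 ≤ ∑ i ∈ range (2 * k + 1), |D i| := Finset.sum_nonneg fun _ _ => abs_nonneg _
  refine ⟨1 + ∑ i ∈ range (2 * k + 1), |D i|, by linarith, fun m hm => ?_⟩
  obtain ⟨b, hb⟩ : ∃ b, m / k = b + 1 :=
    Nat.exists_eq_succ_of_ne_zero (Nat.div_pos hm hk).ne'
  have hr := Nat.mod_lt m hk
  have hle : ∀ j : Fin (b + 1), (if j = 0 then k + m % k else k) ≤ 2 * k := fun j => by
    split_ifs <;> omega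
  have hge : ∀ j : Fin (b + 1), k ≤ if j = 0 then k + m % k else k := fun j => by
    split_ifs <;> omega
  refine polydiscBH_of_composition (hk.trans hm)
    (fun j : Fin (b + 1) => if j = 0 then k + m % k else k) hk hge hle ?_ (by linarith)
    fun j => (hD _ (hk.trans (hge j))).mono ?_
  · rw [Fin.sum_univ_succ]
    simp only [if_true, Fin.succ_ne_zero, if_false, Finset.sum_const, Finset.card_univ,
      Fintype.card_fin, smul_eq_mul]
    have := Nat.div_add_mod m k
    rw [hb] at this
    linarith
  · have := Finset.single_le_sum (f := fun i => |D i|) (fun i _ => abs_nonneg _)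
      (mem_range.2 (Nat.lt_succ_of_le (hle j)))
    have h2 := le_abs_self (D (if j = 0 then k + m % k else k))
    have h3 := h2.trans this
    linarith

section RealPolynomials

variable {n d : ℕ} {P : MvPolynomial (Fin n) ℝ}

lemma sum_support_eq_sum_multiIdx {R : Type*} [AddCommMonoid R] (hP : P.IsHomogeneous d)
    (g : (Fin n →₀ ℕ) → R) (hg : ∀ s, P.coeff s = 0 → g s = 0) :
    ∑ s ∈ P.support, g s = ∑ α ∈ multiIdx n d, g (Finsupp.equivFunOnFinite.symm α) := by
  refine Eq.trans ?_ (Finset.sum_map (multiIdx n d) Finsupp.equivFunOnFinite.symm.toEmbedding g)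
  refine Finset.sum_subset (fun s hs => ?_) fun s _ hs =>
    hg s (MvPolynomial.notMem_support_iff.1 hs)
  refine Finset.mem_map.2 ⟨s, ?_, by ext; simp⟩
  rw [mem_multiIdx, ← Finsupp.degree_eq_sum]
  by_contra hne
  exact MvPolynomial.mem_support_iff.1 hs (hP.coeff_eq_zero hne)

lemma aeval_eq_homEval (hP : P.IsHomogeneous d) (z : Fin n → ℂ) :
    MvPolynomial.aeval z P
      = homEval d (fun α => ((P.coeff (Finsupp.equivFunOnFinite.symm α) : ℝ) : ℂ)) z := by
  rw [MvPolynomial.aeval_def, MvPolynomial.eval₂_eq',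
    sum_support_eq_sum_multiIdx hP _ fun s hs => by simp [hs]]
  rfl

lemma aeval_ofReal (x : Fin n → ℝ) :
    MvPolynomial.aeval (fun i => (x i : ℂ)) P = (MvPolynomial.eval x P : ℂ) := by
  have := MvPolynomial.aeval_algebraMap_apply ℂ x P
  rwa [MvPolynomial.aeval_eq_eval] at this

lemma norm_aeval_le_sum (P : MvPolynomial (Fin n) ℝ) {z : Fin n → ℂ} (hz : ∀ i, ‖z i‖ ≤ 1) :
    ‖MvPolynomial.aeval z P‖ ≤ ∑ s ∈ P.support, |P.coeff s| := by
  rw [MvPolynomial.aeval_def, MvPolynomial.eval₂_eq']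
  refine (norm_sum_le _ _).trans (Finset.sum_le_sum fun s _ => ?_)
  rw [norm_mul, norm_prod]
  simp only [Complex.coe_algebraMap, Complex.norm_real, Real.norm_eq_abs, norm_pow]
  exact mul_le_of_le_one_right (abs_nonneg _)
    (Finset.prod_le_one (fun i _ => by positivity) fun i _ => pow_le_one₀ (norm_nonneg _) (hz i))

lemma abs_eval_le_supOnBox (P : MvPolynomial (Fin n) ℝ) {x : Fin n → ℝ} (hx : ∀ i, |x i| ≤ 1) :
    |MvPolynomial.eval x P| ≤ supOnBox P := by
  refine le_csSup ⟨∑ s ∈ P.support, |P.coeff s|, ?_⟩ ⟨x, fun i => abs_le.1 (hx i), rfl⟩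
  rintro _ ⟨y, hy, rfl⟩
  have := norm_aeval_le_sum P (z := fun i => (y i : ℂ)) fun i => by
    rw [Complex.norm_real]; exact abs_le.2 (hy i)
  rwa [aeval_ofReal, Complex.norm_real] at this

lemma supOnBox_le {S : ℝ} (h : ∀ x : Fin n → ℝ, (∀ i, |x i| ≤ 1) → |MvPolynomial.eval x P| ≤ S) :
    supOnBox P ≤ S := by
  refine csSup_le ⟨_, 0, fun i => by simp, rfl⟩ ?_
  rintro _ ⟨y, hy, rfl⟩
  exact h y fun i => abs_le.2 (hy i)

lemma isHomBHConst_of_polydiscBH (hd : 1 ≤ d) {D : ℝ} (hD : 1 ≤ D) (h : PolydiscBH d D) :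
    IsHomBHConst d (2 ^ d * D) := by
  have h2 : (1 : ℝ) ≤ 2 ^ d := one_le_pow₀ (by norm_num)
  refine ⟨one_le_mul_of_one_le_of_one_le h2 hD, fun n P hP => ?_⟩
  have hd0 : (0 : ℝ) < d := by exact_mod_cast hd
  set S := supOnBox P with hS
  have hS0 : 0 ≤ S := (abs_nonneg _).trans (abs_eval_le_supOnBox P (x := 0) (by simp))
  set p : ℝ := (2 * d : ℝ) / (d + 1) with hp
  have hp0 : 0 < p := by positivity
  have hpinv : ((d + 1 : ℝ) / (2 * d)) = p⁻¹ := by rw [hp, inv_div]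
  have hp1 : p⁻¹ ≤ 1 := by
    rw [← hpinv, div_le_one (by positivity)]
    have : (1 : ℝ) ≤ d := by exact_mod_cast hd
    linarith
  refine le_of_forall_pos_le_add fun ε hε => ?_
  have hT : 0 < 2 ^ d * S + ε / D := by positivity
  set T := 2 ^ d * S + ε / D with hTdef
  have hsum := h.sum_le (a := fun α => ((P.coeff (Finsupp.equivFunOnFinite.symm α) : ℝ) : ℂ)) hT
    fun z hz => by
      refine (norm_homEval_le_of_real _ (S := S) (fun x hx => ?_) hz).trans ?_
      · rw [← aeval_eq_homEval hP, aeval_ofReal, Complex.norm_real]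
        exact abs_eval_le_supOnBox P hx
      · rw [hTdef]
        have : 0 < ε / D := by positivity
        linarith
  rw [sum_support_eq_sum_multiIdx hP _ fun s hs => by
    rw [hs, abs_zero, Real.zero_rpow hp0.ne'], hpinv]
  simp only [Complex.norm_real, Real.norm_eq_abs] at hsum
  calc _ ≤ (D * T ^ p) ^ p⁻¹ := by
        refine Real.rpow_le_rpow ?_ hsum (by positivity)
        exact Finset.sum_nonneg fun _ _ => by positivity
    _ = D ^ p⁻¹ * T := by
        rw [Real.mul_rpow (by positivity) (by positivity), Real.rpow_rpow_inv hT.le hp0.ne']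
    _ ≤ D ^ (1 : ℝ) * T := by gcongr
    _ = 2 ^ d * D * S + ε := by
        rw [Real.rpow_one, hTdef]; field_simp

lemma card_multiIdx_le (n d : ℕ) : #(multiIdx n d) ≤ (d + 1) ^ n := by
  calc #(multiIdx n d) ≤ #(Fintype.piFinset fun _ : Fin n => range (d + 1)) :=
        Finset.card_le_card fun α hα => Fintype.mem_piFinset.2 fun i =>
          mem_range.2 (Nat.lt_succ_of_le (le_of_mem_multiIdx hα i))
    _ = (d + 1) ^ n := by simp

lemma card_support_le (hP : P.IsHomogeneous d) : #P.support ≤ (d + 1) ^ n := by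
  refine le_trans ?_ (card_multiIdx_le n d)
  refine Finset.card_le_card_of_injOn (fun s => ⇑s) (fun s hs => ?_) DFunLike.coe_injective.injOn
  rw [Finset.mem_coe, mem_multiIdx, ← Finsupp.degree_eq_sum]
  by_contra hne
  exact MvPolynomial.mem_support_iff.1 hs (hP.coeff_eq_zero hne)

/-- Values on the polydisc of a polynomial bounded on the real cube bound the constant below. -/
lemma norm_aeval_le_of_isHomBHConst (hd : 1 ≤ d) {C : ℝ} (hC : IsHomBHConst d C)
    (hP : P.IsHomogeneous d)
    (hbd : ∀ x : Fin n → ℝ, (∀ i, |x i| ≤ 1) → |MvPolynomial.eval x P| ≤ 1)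
    {z : Fin n → ℂ} (hz : ∀ i, ‖z i‖ ≤ 1) :
    ‖MvPolynomial.aeval z P‖ ≤ ((d : ℝ) + 1) ^ n * C := by
  have hC0 : 0 ≤ C := zero_le_one.trans hC.1
  have hd0 : (0 : ℝ) < d := by exact_mod_cast hd
  have hcoeff : ∀ s ∈ P.support, |P.coeff s| ≤ C := by
    intro s hs
    have hp0 : 0 < (2 * d : ℝ) / (d + 1) := by positivity
    have hinv : (d + 1 : ℝ) / (2 * d) = ((2 * d : ℝ) / (d + 1))⁻¹ := by rw [inv_div]
    calc |P.coeff s| = (|P.coeff s| ^ ((2 * d : ℝ) / (d + 1))) ^ ((d + 1 : ℝ) / (2 * d)) := by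
          rw [hinv, Real.rpow_rpow_inv (abs_nonneg _) hp0.ne']
      _ ≤ (∑ α ∈ P.support, |P.coeff α| ^ ((2 * d : ℝ) / (d + 1))) ^ ((d + 1 : ℝ) / (2 * d)) := by
          refine Real.rpow_le_rpow (by positivity) ?_ (by positivity)
          exact Finset.single_le_sum (f := fun α => |P.coeff α| ^ ((2 * d : ℝ) / (d + 1)))
            (fun _ _ => by positivity) hs
      _ ≤ C * supOnBox P := hC.2 n P hP
      _ ≤ C := mul_le_of_le_one_right hC0 (supOnBox_le hbd)
  calc _ ≤ ∑ s ∈ P.support, |P.coeff s| := norm_aeval_le_sum P hz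
    _ ≤ #P.support * C := by
        rw [← nsmul_eq_mul]; exact Finset.sum_le_card_nsmul _ _ _ hcoeff
    _ ≤ ((d : ℝ) + 1) ^ n * C := by
        gcongr
        exact_mod_cast card_support_le hP

end RealPolynomials

/-- Homogeneous polynomials of degree `2 ^ k`, bounded by one on the real cube, for which the
complexification constant `2 ^ (2 ^ k - 1)` is attained. -/
lemma exists_extremal_polynomial (k : ℕ) :
    ∃ (n : ℕ) (P : MvPolynomial (Fin n) ℝ), P.IsHomogeneous (2 ^ k) ∧
      (∀ x : Fin n → ℝ, (∀ i, |x i| ≤ 1) → |MvPolynomial.eval x P| ≤ 1) ∧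
      ∃ z : Fin n → ℂ, (∀ i, ‖z i‖ ≤ 1) ∧ MvPolynomial.aeval z P = 2 ^ (2 ^ k - 1) := by
  induction k with
  | zero =>
    exact ⟨1, MvPolynomial.X 0, MvPolynomial.isHomogeneous_X _ _, fun x hx => by simpa using hx 0,
      1, by simp, by simp⟩
  | succ k ih =>
    obtain ⟨n, P, hP, hbd, z, hz, hPz⟩ := ih
    obtain ⟨ω, hω⟩ : ∃ ω : ℂ, ω ^ (2 ^ k * 2) = -1 :=
      IsAlgClosed.exists_pow_nat_eq _ (by positivity)
    have hω1 : ‖ω‖ = 1 := by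
      have : ‖ω‖ ^ (2 ^ k * 2) = 1 := by rw [← norm_pow, hω, norm_neg, norm_one]
      exact (pow_eq_one_iff_of_nonneg (norm_nonneg _) (by positivity)).1 this
    refine ⟨n + n, MvPolynomial.rename (Fin.castAdd n) P ^ 2
      - MvPolynomial.rename (Fin.natAdd n) P ^ 2, ?_, ?_, ?_⟩
    · rw [pow_succ]
      exact (hP.rename_isHomogeneous.pow 2).sub (hP.rename_isHomogeneous.pow 2)
    · intro x hx
      have h1 := hbd (x ∘ Fin.castAdd n) fun i => hx _
      have h2 := hbd (x ∘ Fin.natAdd n) fun i => hx _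
      simp only [map_sub, map_pow, MvPolynomial.eval_rename]
      rw [← sq_le_one_iff_abs_le_one] at h1 h2
      rw [abs_le]
      constructor <;> nlinarith [sq_nonneg (MvPolynomial.eval (x ∘ Fin.castAdd n) P),
        sq_nonneg (MvPolynomial.eval (x ∘ Fin.natAdd n) P)]
    · refine ⟨Fin.append z fun i => ω * z i, fun i => ?_, ?_⟩
      · refine Fin.addCases (fun j => ?_) (fun j => ?_) i
        · rw [Fin.append_left]; exact hz j
        · rw [Fin.append_right, norm_mul, hω1, one_mul]; exact hz j
      · have hl : (Fin.append z fun i => ω * z i) ∘ Fin.castAdd n = z :=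
          funext fun i => Fin.append_left _ _ i
        have hr : (Fin.append z fun i => ω * z i) ∘ Fin.natAdd n = fun i => ω * z i :=
          funext fun i => Fin.append_right _ _ i
        simp only [map_sub, map_pow, MvPolynomial.aeval_rename]
        rw [hl, hr, aeval_eq_homEval hP (fun i => ω * z i), homEval_mul, ← aeval_eq_homEval hP,
          hPz, mul_pow, ← pow_mul, ← pow_mul, hω]
        have : 2 ^ (k + 1) - 1 = (2 ^ k - 1) * 2 + 1 := by
          have := Nat.one_le_two_pow (n := k)
          rw [pow_succ]; omega
        rw [this]
        ring

/-- The optimal constants grow at most exponentially with base `2`. -/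
lemma eventually_le_pow (BH : ℕ → ℝ)
    (hBH : ∀ d : ℕ, 1 ≤ d → IsLeast {C : ℝ | IsHomBHConst d C} (BH d)) {L : ℝ} (hL : 2 < L) :
    ∀ᶠ d : ℕ in Filter.atTop, BH d ≤ L ^ d := by
  have hlim : Filter.Tendsto (fun k : ℕ => 2 * (16 : ℝ) ^ (1 / ((k : ℝ) + 1))) Filter.atTop
      (nhds 2) := by
    have h := (tendsto_const_nhds (x := (16 : ℝ))).rpow
      (tendsto_one_div_add_atTop_nhds_zero_nat (𝕜 := ℝ)) (Or.inl (by norm_num))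
    simpa using h.const_mul 2
  obtain ⟨k, hkL, hk⟩ :=
    ((hlim.eventually_lt_const hL).and (Filter.eventually_ge_atTop 1)).exists
  set q : ℝ := 2 * (16 : ℝ) ^ (1 / ((k : ℝ) + 1)) with hq
  have hq0 : 0 < q := by positivity
  obtain ⟨C, hC, h⟩ := exists_polydiscBH_growth hk
  have hdecay := tendsto_pow_const_mul_const_pow_of_abs_lt_one (8 * k) (r := q / L)
    (by rw [abs_of_pos (by positivity), div_lt_one (by linarith)]; exact hkL)
  have hsmall := (hdecay.const_mul (81 * C ^ 2)).eventually_lt_const (u := 1)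
    (by rw [mul_zero]; exact one_pos)
  filter_upwards [hsmall, Filter.eventually_ge_atTop k] with d hd hkd
  have hd1 : 1 ≤ d := hk.trans hkd
  have hd1' : (1 : ℝ) ≤ d := by exact_mod_cast hd1
  have hbase : (1 : ℝ) ≤ (4 : ℝ) ^ ((d : ℝ) / (k + 1)) * (9 * (d : ℝ) ^ (2 * (2 * k)) * C) := by
    have h1 : (1 : ℝ) ≤ (4 : ℝ) ^ ((d : ℝ) / (k + 1)) :=
      Real.one_le_rpow (by norm_num) (by positivity)
    have h2 := one_le_pow₀ (n := 2 * (2 * k)) hd1'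
    exact one_le_mul_of_one_le_of_one_le h1 (one_le_mul_of_one_le_of_one_le (by linarith) hC)
  refine ((hBH d hd1).2 (isHomBHConst_of_polydiscBH hd1 (one_le_pow₀ hbase) (h d hkd))).trans ?_
  have hfour : ((4 : ℝ) ^ ((d : ℝ) / (k + 1))) ^ 2 = ((16 : ℝ) ^ (1 / ((k : ℝ) + 1))) ^ d := by
    rw [← Real.rpow_natCast, ← Real.rpow_natCast, ← Real.rpow_mul (by norm_num),
      ← Real.rpow_mul (by norm_num), show (16 : ℝ) = 4 ^ (2 : ℝ) by norm_num,
      ← Real.rpow_mul (by norm_num)]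
    congr 1
    push_cast
    ring
  have hLd : (0 : ℝ) < L ^ d := by positivity
  calc (2 : ℝ) ^ d * ((4 : ℝ) ^ ((d : ℝ) / (k + 1)) * (9 * (d : ℝ) ^ (2 * (2 * k)) * C)) ^ 2
      = 81 * C ^ 2 * ((d : ℝ) ^ (8 * k) * (q / L) ^ d) * L ^ d := by
        rw [mul_pow, hfour, div_pow, hq, mul_pow]
        field_simp
        ring
    _ ≤ 1 * L ^ d := by gcongr
    _ = L ^ d := one_mul _

/-- The optimal constants grow at least exponentially with base `2` along a subsequence. -/
lemma frequently_pow_le (BH : ℕ → ℝ)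
    (hBH : ∀ d : ℕ, 1 ≤ d → IsLeast {C : ℝ | IsHomBHConst d C} (BH d)) {L : ℝ} (hL0 : 0 < L)
    (hL : L < 2) : ∃ᶠ d : ℕ in Filter.atTop, L ^ d ≤ BH d := by
  obtain ⟨m, hm⟩ := exists_pow_lt_of_lt_one (one_half_pos (α := ℝ))
    (show L / 2 < 1 by linarith)
  have hk : L ^ (2 ^ m) < 2 ^ (2 ^ m - 1) := by
    have h1 : (L / 2) ^ (2 ^ m) < 1 / 2 :=
      (pow_le_pow_of_le_one (by positivity) (by linarith) Nat.lt_two_pow_self.le).trans_lt hm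
    have h2 : (2 : ℝ) ^ (2 ^ m) = 2 ^ (2 ^ m - 1) * 2 := by
      rw [← pow_succ, Nat.sub_add_cancel Nat.one_le_two_pow]
    rw [div_pow, div_lt_iff₀ (by positivity), h2] at h1
    linarith
  obtain ⟨n, P, hP, hbd, z, hz, hPz⟩ := exists_extremal_polynomial m
  set D := 2 ^ m with hD
  have hD1 : 1 ≤ D := Nat.one_le_two_pow
  set r : ℝ := L ^ D / 2 ^ (D - 1) with hr
  have hr0 : 0 < r := by positivity
  have hdecay := tendsto_pow_const_mul_const_pow_of_abs_lt_one n (r := r)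
    (by rw [abs_of_pos hr0, hr, div_lt_one (by positivity)]; exact hk)
  have hsmall := (hdecay.const_mul (((D : ℝ) + 1) ^ n)).eventually_lt_const (u := 1)
    (by rw [mul_zero]; exact one_pos)
  have hev : ∀ᶠ N : ℕ in Filter.atTop, L ^ (D * N) ≤ BH (D * N) := by
    filter_upwards [hsmall, Filter.eventually_ge_atTop 1] with N hN hN1
    have hN1' : (1 : ℝ) ≤ N := by exact_mod_cast hN1
    have hDN : 1 ≤ D * N := Nat.mul_pos hD1 hN1
    have hadm := (hBH (D * N) hDN).1
    have hB0 : 0 ≤ BH (D * N) := zero_le_one.trans hadm.1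
    have key := norm_aeval_le_of_isHomBHConst hDN hadm (hP.pow N)
      (fun x hx => by rw [map_pow, abs_pow]; exact pow_le_one₀ (abs_nonneg _) (hbd x hx)) hz
    rw [map_pow, hPz, norm_pow, norm_pow, Complex.norm_two] at key
    calc L ^ (D * N) = r ^ N * (2 ^ (D - 1)) ^ N := by
          rw [← mul_pow, hr, div_mul_cancel₀ _ (by positivity), pow_mul]
      _ ≤ r ^ N * ((((D * N : ℕ) : ℝ) + 1) ^ n * BH (D * N)) := by gcongr
      _ ≤ r ^ N * ((((D : ℝ) + 1) * N) ^ n * BH (D * N)) := by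
          gcongr
          push_cast
          linarith
      _ = ((D : ℝ) + 1) ^ n * ((N : ℝ) ^ n * r ^ N) * BH (D * N) := by rw [mul_pow]; ring
      _ ≤ 1 * BH (D * N) := by gcongr
      _ = BH (D * N) := one_mul _
  exact (Filter.tendsto_id.const_mul_atTop' (Nat.lt_of_succ_le hD1)).frequently hev.frequently

/-- If `BH d` is the smallest admissible Bohnenblust–Hille constant for `d`-homogeneous real
polynomials on `[-1,1]^n`, then `limsup_{d→∞} (BH d)^{1/d} = 2`. -/
theorem limsup_bh_real_homogeneous (BH : ℕ → ℝ)
    (hBH : ∀ d : ℕ, 1 ≤ d → IsLeast {C : ℝ | IsHomBHConst d C} (BH d)) :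
    Filter.limsup (fun d : ℕ => (BH d) ^ ((d : ℝ)⁻¹)) Filter.atTop = 2 := by
  have hge : ∀ d : ℕ, 1 ≤ d → 1 ≤ BH d := fun d hd => (hBH d hd).1.1
  have hupper : ∀ L : ℝ, 2 < L → ∀ᶠ d : ℕ in Filter.atTop, BH d ^ ((d : ℝ)⁻¹) ≤ L := by
    intro L hL
    filter_upwards [eventually_le_pow BH hBH hL, Filter.eventually_ge_atTop 1] with d hd hd1
    have hL0 : 0 ≤ L := by linarith
    calc BH d ^ ((d : ℝ)⁻¹) ≤ (L ^ d) ^ ((d : ℝ)⁻¹) :=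
          Real.rpow_le_rpow (zero_le_one.trans (hge d hd1)) hd (by positivity)
      _ = L := Real.pow_rpow_inv_natCast hL0 (by omega)
  have hnonneg : ∀ᶠ d : ℕ in Filter.atTop, (0 : ℝ) ≤ BH d ^ ((d : ℝ)⁻¹) := by
    filter_upwards [Filter.eventually_ge_atTop 1] with d hd
    exact Real.rpow_nonneg (zero_le_one.trans (hge d hd)) _
  refine le_antisymm (le_of_forall_gt_imp_ge_of_dense fun L hL => ?_)
    (le_of_forall_lt_imp_le_of_dense fun c hc => ?_)
  · exact Filter.limsup_le_of_le
      (Filter.isBoundedUnder_of_eventually_ge hnonneg).isCoboundedUnder_le (hupper L hL)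
  · refine (le_max_left c 1).trans (Filter.le_limsup_of_frequently_le ?_
      (Filter.isBoundedUnder_of_eventually_le (hupper 3 (by norm_num))))
    have hL1 : 1 ≤ max c 1 := le_max_right _ _
    refine ((frequently_pow_le BH hBH (by linarith) (max_lt hc one_lt_two)).and_eventually
      (Filter.eventually_ge_atTop 1)).mono fun d hd => ?_
    calc max c 1 = (max c 1 ^ d) ^ ((d : ℝ)⁻¹) :=
          (Real.pow_rpow_inv_natCast (by linarith) (by omega)).symm
      _ ≤ BH d ^ ((d : ℝ)⁻¹) := Real.rpow_le_rpow (by positivity) hd.1 (by positivity)
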